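/- Let d ≥ 2, let μ be the Haar probability measure on U(d), let ν be any Borel probability measure on U(d), let O be a d×d Hermitian matrix and ρ a pure-state density matrix (positive semidefinite, Tr[ρ] = 1, ρ² = ρ). Set A(ρ) := ∫ V ρ V† dμ(V) − ∫ U ρ U† dν(U) and A₂(ρ⊗ρ) := ∫ (V ⊗ V)(ρ ⊗ ρ)(V ⊗ V)† dμ(V) − ∫ (U ⊗ U)(ρ ⊗ ρ)(U ⊗ U)† dν(U). Then the variance of the cost under ν satisfies Var_ν[C] := ∫ (Tr[O U ρ U†])² dν(U) − (∫ Tr[O U ρ U†] dν(U))² = β − Tr[(O ⊗ O) · A₂(ρ⊗ρ)] + α·Tr[O·A(ρ)] − (Tr[O·A(ρ)])², where β := ((Tr[O])² + Tr[O²])/(d² − 1) · (1 − 1/d) − (Tr[O])²/d² and α := 2·Tr[O]/d. -/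

import Mathlib

open MeasureTheory Matrix
open scoped Kronecker ComplexOrder

noncomputable section

attribute [local instance] Matrix.frobeniusNormedAddCommGroup Matrix.frobeniusNormedSpace

local instance {n m : Type*} [Fintype n] [Fintype m] : MeasurableSpace (Matrix n m ℂ) :=
  borel _

local instance {n m : Type*} [Fintype n] [Fintype m] : BorelSpace (Matrix n m ℂ) := ⟨rfl⟩

/-- The Frobenius (Hilbert–Schmidt) norm `‖M‖₂ = √Tr[M† M]`. -/
def frobNorm {n : Type*} [Fintype n] (M : Matrix n n ℂ) : ℝ :=
  Real.sqrt (Matrix.trace (star M * M)).re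

/-- The unitary group. -/
abbrev UG (d : ℕ) := Matrix.unitaryGroup (Fin d) ℂ

lemma ug_compact (d : ℕ) : CompactSpace (UG d) := by
  apply isCompact_iff_compactSpace.mp
  have : ProperSpace (Matrix (Fin d) (Fin d) ℂ) := FiniteDimensional.proper ℂ _
  apply Metric.isCompact_of_isClosed_isBounded
  · have : ((Matrix.unitaryGroup (Fin d) ℂ : Submonoid _) : Set (Matrix (Fin d) (Fin d) ℂ))
        = {U | U * star U = 1} := by
      ext U; exact Matrix.mem_unitaryGroup_iff
    rw [this]
    exact isClosed_eq (by fun_prop) continuous_const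
  · rw [isBounded_iff_forall_norm_le]
    refine ⟨((∑ i : Fin d, ∑ j : Fin d, (1:ℝ) ^ (2:ℝ))) ^ (1/2 : ℝ), fun U hU => ?_⟩
    rw [Matrix.frobenius_norm_def]
    gcongr with i _ j _
    exact entry_norm_bound_of_unitary hU i j

lemma ug_integrable {d : ℕ} (μ : Measure (UG d)) [IsProbabilityMeasure μ]
    {E : Type*} [NormedAddCommGroup E] [SecondCountableTopology E] (f : UG d → E)
    (hf : Continuous f) : Integrable f μ := by
  have := ug_compact d
  exact hf.integrable_of_hasCompactSupport (HasCompactSupport.of_compactSpace f)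

/-- The conjugated state. -/
def RR {d : ℕ} (ρ : Matrix (Fin d) (Fin d) ℂ) (V : UG d) : Matrix (Fin d) (Fin d) ℂ :=
  V.1 * ρ * star V.1

lemma RR_cont {d : ℕ} (ρ : Matrix (Fin d) (Fin d) ℂ) : Continuous (RR ρ) := by
  unfold RR
  fun_prop

lemma RR_cont' {d : ℕ} (ρ : Matrix (Fin d) (Fin d) ℂ) (i j : Fin d) :
    Continuous (fun V => RR ρ V i j) := (RR_cont ρ).matrix_elem i j

lemma RR_trace {d : ℕ} (ρ : Matrix (Fin d) (Fin d) ℂ) (V : UG d) : (RR ρ V).trace = ρ.trace := by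
  unfold RR
  rw [Matrix.trace_mul_comm, ← Matrix.mul_assoc]
  have : star V.1 * V.1 = 1 := Matrix.mem_unitaryGroup_iff'.mp V.2
  simp [this]

lemma RR_sq {d : ℕ} (ρ : Matrix (Fin d) (Fin d) ℂ) (h : ρ * ρ = ρ) (V : UG d) :
    RR ρ V * RR ρ V = RR ρ V := by
  unfold RR
  have : star V.1 * V.1 = 1 := Matrix.mem_unitaryGroup_iff'.mp V.2
  calc _ = V.1 * ρ * (star V.1 * V.1) * ρ * star V.1 := by simp only [Matrix.mul_assoc]
    _ = V.1 * (ρ * ρ) * star V.1 := by rw [this]; simp only [Matrix.mul_assoc, Matrix.mul_one]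
    _ = _ := by rw [h]

lemma haar_inv {d : ℕ} (μ : Measure (UG d)) [μ.IsHaarMeasure] (ρ : Matrix (Fin d) (Fin d) ℂ)
    (f : Matrix (Fin d) (Fin d) ℂ → ℂ) (W : Matrix (Fin d) (Fin d) ℂ)
    (hW : W ∈ Matrix.unitaryGroup (Fin d) ℂ) :
    ∫ V, f (W * RR ρ V * star W) ∂μ = ∫ V, f (RR ρ V) ∂μ := by
  rw [← integral_mul_left_eq_self (fun V : UG d => f (RR ρ V)) ⟨W, hW⟩]
  congr 1
  ext V
  simp [RR, Matrix.mul_assoc]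

lemma haar_swap {d : ℕ} (μ : Measure (UG d)) [μ.IsHaarMeasure] (ρ : Matrix (Fin d) (Fin d) ℂ)
    (f : Matrix (Fin d) (Fin d) ℂ → ℂ) (i j : Fin d) :
    ∫ V, f ((RR ρ V).submatrix (Equiv.swap i j) (Equiv.swap i j)) ∂μ = ∫ V, f (RR ρ V) ∂μ := by
  have hs : star (Matrix.swap ℂ i j) = Matrix.swap ℂ i j := conjTranspose_swap i j
  rw [← haar_inv μ ρ f (Matrix.swap ℂ i j) (by
    rw [Matrix.mem_unitaryGroup_iff, hs, swap_mul_self])]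
  congr 1
  ext V
  rw [hs]
  congr 1
  ext a b
  simp [Matrix.swap, PEquiv.toMatrix_toPEquiv_mul, PEquiv.mul_toMatrix_toPEquiv]

lemma haar_phase {d : ℕ} (μ : Measure (UG d)) [μ.IsHaarMeasure] (ρ : Matrix (Fin d) (Fin d) ℂ)
    (f : Matrix (Fin d) (Fin d) ℂ → ℂ) (u : Fin d → ℂ) (hu : ∀ i, u i * star (u i) = 1) :
    ∫ V, f (Matrix.of fun a b => u a * RR ρ V a b * star (u b)) ∂μ = ∫ V, f (RR ρ V) ∂μ := by
  have hs : star (Matrix.diagonal u) = Matrix.diagonal (star u) := diagonal_conjTranspose u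
  rw [← haar_inv μ ρ f (Matrix.diagonal u) (by
    rw [Matrix.mem_unitaryGroup_iff, hs, diagonal_mul_diagonal, ← diagonal_one]
    congr 1; ext i; exact hu i)]
  congr 1
  ext V
  rw [hs]
  congr 1
  ext a b
  simp [Matrix.diagonal_mul, Matrix.mul_diagonal]

lemma rot_mem {d : ℕ} (P : Matrix (Fin d) (Fin d) ℂ) (h1 : star P = P) (h2 : P * P = 1) :
    ((Real.sqrt 2 : ℂ)⁻¹ • (1 + Complex.I • P)) ∈ Matrix.unitaryGroup (Fin d) ℂ := by
  have h3 : ((Real.sqrt 2 : ℂ)⁻¹ * (Real.sqrt 2 : ℂ)⁻¹) = 1/2 := by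
    rw [← mul_inv, ← Complex.ofReal_mul, Real.mul_self_sqrt (by norm_num)]; norm_num
  rw [Matrix.mem_unitaryGroup_iff, star_smul, star_add, star_smul, h1, star_one, smul_mul_smul]
  have : (1 + Complex.I • P) * (1 + star Complex.I • P) = (2:ℂ) • 1 := by
    simp [add_mul, mul_add, h2, smul_smul]
    module
  rw [this]
  simp [h3, smul_smul]

lemma haar_rot {d : ℕ} (μ : Measure (UG d)) [μ.IsHaarMeasure] (ρ : Matrix (Fin d) (Fin d) ℂ)
    (i j : Fin d) :
    ∫ V, ((1/2) * (RR ρ V i i + RR ρ V j j + Complex.I * (RR ρ V j i - RR ρ V i j))) ^ 2 ∂μ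
      = ∫ V, (RR ρ V i i) ^ 2 ∂μ := by
  have hs : star (Matrix.swap ℂ i j) = Matrix.swap ℂ i j := conjTranspose_swap i j
  have h3 : ((Real.sqrt 2 : ℂ)⁻¹ * (Real.sqrt 2 : ℂ)⁻¹) = 1/2 := by
    rw [← mul_inv, ← Complex.ofReal_mul, Real.mul_self_sqrt (by norm_num)]; norm_num
  rw [← haar_inv μ ρ (fun M => (M i i) ^ 2) _ (rot_mem (Matrix.swap ℂ i j) hs (swap_mul_self _ _))]
  congr 1
  ext V
  congr 1
  rw [star_smul, star_add, star_smul, hs, star_one, smul_mul_assoc, smul_mul_smul, ]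
  have : star (Real.sqrt 2 : ℂ)⁻¹ = (Real.sqrt 2 : ℂ)⁻¹ := by simp
  rw [this, h3]
  simp [add_mul, mul_add]
  ring_nf
  simp
  ring

lemma mom1 {d : ℕ} (hd : 2 ≤ d) (μ : Measure (UG d)) [μ.IsHaarMeasure] [IsProbabilityMeasure μ]
    (ρ : Matrix (Fin d) (Fin d) ℂ) (hρ1 : ρ.trace = 1) (i : Fin d) :
    ∫ V, RR ρ V i i ∂μ = 1 / d := by
  have hc := RR_cont' ρ
  have h1 : ∀ j, ∫ V, RR ρ V j j ∂μ = ∫ V, RR ρ V i i ∂μ := fun j => by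
    have := haar_swap μ ρ (fun M => M i i) i j
    simpa using this
  have h2 : ∑ j, ∫ V, RR ρ V j j ∂μ = 1 := by
    rw [← integral_finsetSum _ (fun j _ => ug_integrable μ _ (hc j j))]
    have : ∀ V, ∑ j, RR ρ V j j = 1 := fun V => by
      rw [← hρ1, ← RR_trace ρ V]; rfl
    simp [this]
  have hd0 : (d : ℂ) ≠ 0 := by norm_cast; omega
  simp only [h1, Finset.sum_const, Finset.card_univ, Fintype.card_fin, nsmul_eq_mul] at h2
  field_simp
  linear_combination h2

lemma row_sum {d : ℕ} (hd : 2 ≤ d) (i j : Fin d) (hij : j ≠ i) (F : Fin d → ℂ) (s : ℂ)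
    (hF : ∀ k, k ≠ i → F k = F j) (hs : ∑ k, F k = s) : F i + ((d : ℂ) - 1) * F j = s := by
  rw [← hs, ← Finset.add_sum_erase _ _ (Finset.mem_univ i),
    Finset.sum_congr rfl (fun k hk => hF k (Finset.ne_of_mem_erase hk))]
  simp [Nat.cast_sub (show 1 ≤ d by omega)]

lemma mom2_rel {d : ℕ} (μ : Measure (UG d)) [μ.IsHaarMeasure] [IsProbabilityMeasure μ]
    (ρ : Matrix (Fin d) (Fin d) ℂ) (i j : Fin d) (hij : j ≠ i) :
    ∫ V, RR ρ V i i * RR ρ V i i ∂μ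
      = ∫ V, RR ρ V i i * RR ρ V j j ∂μ + ∫ V, RR ρ V i j * RR ρ V j i ∂μ := by
  have hc := RR_cont' ρ
  have hI : ∀ a b k l, Integrable (fun V => RR ρ V a b * RR ρ V k l) μ := fun a b k l =>
    ug_integrable μ _ ((hc a b).mul (hc k l))
  have hrot := haar_rot μ ρ i j
  have hii : ∫ V, RR ρ V j j * RR ρ V j j ∂μ = ∫ V, RR ρ V i i * RR ρ V i i ∂μ := by
    simpa using haar_swap μ ρ (fun M => M i i * M i i) i j
  have hu : ∀ k, (fun k => if k = i then Complex.I else 1) k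
      * star ((fun k => if k = i then Complex.I else 1) k) = 1 := by
    intro k; by_cases h : k = i <;> simp [h]
  have key := fun f => haar_phase μ ρ f _ hu
  have z1 : ∫ V, RR ρ V i j * RR ρ V i j ∂μ = 0 := by
    have := key (fun M => M i j * M i j)
    simp [hij] at this
    have e : ∀ V, Complex.I * RR ρ V i j * (Complex.I * RR ρ V i j)
      = -1 * (RR ρ V i j * RR ρ V i j) := fun V => by linear_combination (RR ρ V i j * RR ρ V i j) * Complex.I_mul_I
    simp only [e, integral_const_mul] at this
    linear_combination (-1/2) * this
  have z2 : ∫ V, RR ρ V j i * RR ρ V j i ∂μ = 0 := by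
    have := key (fun M => M j i * M j i)
    simp [hij] at this
    have e : ∀ V, RR ρ V j i * Complex.I * (RR ρ V j i * Complex.I)
      = -1 * (RR ρ V j i * RR ρ V j i) := fun V => by linear_combination (RR ρ V j i * RR ρ V j i) * Complex.I_mul_I
    simp only [e, integral_const_mul] at this
    linear_combination (-1/2) * this
  have hne : (1 - Complex.I) ≠ 0 := fun h => by simpa using congrArg Complex.re h
  have hne' : (1 + Complex.I) ≠ 0 := fun h => by simpa using congrArg Complex.re h
  have z3 : ∀ k, ∫ V, RR ρ V k k * RR ρ V i j ∂μ = 0 := by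
    intro k
    have := key (fun M => M k k * M i j)
    have e : ∀ V, (if k = i then Complex.I else 1) * RR ρ V k k * star (if k = i then Complex.I else 1)
        * ((if i = i then Complex.I else 1) * RR ρ V i j * star (if j = i then Complex.I else 1))
        = Complex.I * (RR ρ V k k * RR ρ V i j) := fun V => by
      have := hu k
      simp only [hij, if_true, if_false, star_one] at this ⊢
      linear_combination Complex.I * (RR ρ V k k * RR ρ V i j) * this
    replace this := (integral_congr_ae (μ := μ) (Filter.Eventually.of_forall e)).symm.trans this
    rw [integral_const_mul] at this
    have : (1 - Complex.I) * ∫ V, RR ρ V k k * RR ρ V i j ∂μ = 0 := by linear_combination -this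
    exact (mul_eq_zero.mp this).resolve_left hne
  have z4 : ∀ k, ∫ V, RR ρ V k k * RR ρ V j i ∂μ = 0 := by
    intro k
    have := key (fun M => M k k * M j i)
    have e : ∀ V, (if k = i then Complex.I else 1) * RR ρ V k k * star (if k = i then Complex.I else 1)
        * ((if j = i then Complex.I else 1) * RR ρ V j i * star (if i = i then Complex.I else 1))
        = -Complex.I * (RR ρ V k k * RR ρ V j i) := fun V => by
      have := hu k
      have h' : star Complex.I = -Complex.I := Complex.conj_I
      simp only [hij, if_true, if_false, h'] at this ⊢
      linear_combination -Complex.I * (RR ρ V k k * RR ρ V j i) * this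
    replace this := (integral_congr_ae (μ := μ) (Filter.Eventually.of_forall e)).symm.trans this
    rw [integral_const_mul] at this
    have : (1 + Complex.I) * ∫ V, RR ρ V k k * RR ρ V j i ∂μ = 0 := by linear_combination -this
    exact (mul_eq_zero.mp this).resolve_left hne'
  have hexp : ∀ V, ((1/2) * (RR ρ V i i + RR ρ V j j + Complex.I * (RR ρ V j i - RR ρ V i j))) ^ 2
      = (1/4) * (RR ρ V i i * RR ρ V i i) + (1/4) * (RR ρ V j j * RR ρ V j j)
        + (1/2) * (RR ρ V i i * RR ρ V j j)
        + (-1/4) * (RR ρ V j i * RR ρ V j i) + (-1/4) * (RR ρ V i j * RR ρ V i j)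
        + (1/2) * (RR ρ V i j * RR ρ V j i)
        + (Complex.I/2) * (RR ρ V i i * RR ρ V j i) + (-Complex.I/2) * (RR ρ V i i * RR ρ V i j)
        + (Complex.I/2) * (RR ρ V j j * RR ρ V j i) + (-Complex.I/2) * (RR ρ V j j * RR ρ V i j) := by
    intro V
    linear_combination (1/4) * (RR ρ V j i - RR ρ V i j)^2 * Complex.I_mul_I
  simp only [hexp, pow_two (RR ρ _ i i)] at hrot
  have hI' : ∀ c a b k l, Integrable (fun V => c * (RR ρ V a b * RR ρ V k l)) μ := fun c a b k l =>
    (hI a b k l).const_mul c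
  rw [integral_add (by fun_prop (disch := simp)) (hI' _ _ _ _ _)] at hrot
  iterate 8 rw [integral_add (by fun_prop (disch := simp)) (hI' _ _ _ _ _)] at hrot
  simp only [integral_const_mul, z1, z2, z3, z4, hii] at hrot
  linear_combination -2 * hrot

lemma mom2 {d : ℕ} (hd : 2 ≤ d) (μ : Measure (UG d)) [μ.IsHaarMeasure] [IsProbabilityMeasure μ]
    (ρ : Matrix (Fin d) (Fin d) ℂ) (hρ1 : ρ.trace = 1) (hρ2 : ρ * ρ = ρ) (i j : Fin d) :
    ∫ V, RR ρ V i i * RR ρ V j j ∂μ = (1 + if i = j then 1 else 0) / (d * (d + 1)) := by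
  have hc := RR_cont' ρ
  have hI : ∀ a b k l, Integrable (fun V => RR ρ V a b * RR ρ V k l) μ := fun a b k l =>
    ug_integrable μ _ ((hc a b).mul (hc k l))
  have hd0 : (d : ℂ) ≠ 0 := by norm_cast; omega
  have hd1 : (d : ℂ) + 1 ≠ 0 := by norm_cast
  have hd2 : (d : ℂ) - 1 ≠ 0 := by
    rw [sub_ne_zero]; norm_cast; omega
  have sB : ∑ k, ∫ V, RR ρ V i i * RR ρ V k k ∂μ = 1 / d := by
    rw [← integral_finsetSum _ (fun k _ => hI _ _ _ _), ← mom1 hd μ ρ hρ1 i]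
    congr 1; ext V
    rw [← Finset.mul_sum]
    have : ∑ k, RR ρ V k k = 1 := by rw [← hρ1, ← RR_trace ρ V]; rfl
    rw [this, mul_one]
  have sC : ∑ k, ∫ V, RR ρ V i k * RR ρ V k i ∂μ = 1 / d := by
    rw [← integral_finsetSum _ (fun k _ => hI _ _ _ _), ← mom1 hd μ ρ hρ1 i]
    congr 1; ext V
    rw [← Matrix.mul_apply, RR_sq ρ hρ2]
  have main : ∀ l, l ≠ i →
      ∫ V, RR ρ V i i * RR ρ V i i ∂μ = 2 / (d * (d + 1)) ∧
      ∫ V, RR ρ V i i * RR ρ V l l ∂μ = 1 / (d * (d + 1)) := by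
    intro l hl
    have hB := row_sum hd i l hl _ _ (fun k hk => by
      simpa [Equiv.swap_apply_of_ne_of_ne hl.symm hk.symm]
        using haar_swap μ ρ (fun M => M i i * M l l) l k) sB
    have hC := row_sum hd i l hl _ _ (fun k hk => by
      simpa [Equiv.swap_apply_of_ne_of_ne hl.symm hk.symm]
        using haar_swap μ ρ (fun M => M i l * M l i) l k) sC
    have hr := mom2_rel μ ρ i l hl
    beta_reduce at hB hC
    generalize ∫ V, RR ρ V i i * RR ρ V i i ∂μ = a at *
    generalize ∫ V, RR ρ V i i * RR ρ V l l ∂μ = b at *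
    generalize ∫ V, RR ρ V i l * RR ρ V l i ∂μ = c at *
    have hbc : b = c := by
      have : ((d:ℂ) - 1) * (b - c) = 0 := by linear_combination hB - hC
      exact sub_eq_zero.mp ((mul_eq_zero.mp this).resolve_left hd2)
    subst hbc
    have hb : b = 1 / (d * (d + 1)) := by
      subst hr
      field_simp at hB ⊢
      linear_combination hB
    exact ⟨by rw [hr, hb]; ring, hb⟩
  by_cases h : i = j
  · subst h
    have : Nontrivial (Fin d) := Fin.nontrivial_iff_two_le.mpr hd
    obtain ⟨l, hl⟩ := exists_ne i
    rw [(main l hl).1]; norm_num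
  · rw [(main j (Ne.symm h)).2]; simp [h]

/-- First and second moments of the cost under the Haar measure. -/
lemma cost_moments {d : ℕ} (hd : 2 ≤ d) (μ : Measure (UG d)) [μ.IsHaarMeasure]
    [IsProbabilityMeasure μ] (ρ : Matrix (Fin d) (Fin d) ℂ) (hρ1 : ρ.trace = 1) (hρ2 : ρ * ρ = ρ)
    (O : Matrix (Fin d) (Fin d) ℂ) (hO : O.IsHermitian) :
    (∫ V, (O * RR ρ V).trace ∂μ = O.trace / d) ∧
    (∫ V, (O * RR ρ V).trace ^ 2 ∂μ = (O.trace ^ 2 + (O * O).trace) / (d * (d + 1))) := by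
  have hc := RR_cont' ρ
  obtain ⟨W, hW, l, hOl⟩ : ∃ W ∈ Matrix.unitaryGroup (Fin d) ℂ, ∃ l : Fin d → ℂ,
      O = W * diagonal l * star W := by
    have := hO.spectral_theorem
    rw [Unitary.conjStarAlgAut_apply] at this
    exact ⟨_, hO.eigenvectorUnitary.2, _, this⟩
  have hWW : star W * W = 1 := Matrix.mem_unitaryGroup_iff'.mp hW
  have htr : O.trace = ∑ i, l i := by
    rw [hOl, Matrix.trace_mul_comm, ← Matrix.mul_assoc, hWW, Matrix.one_mul, Matrix.trace_diagonal]
  have htr2 : (O * O).trace = ∑ i, l i * l i := by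
    have : O * O = W * (diagonal l * ((star W * W) * diagonal l)) * star W := by
      rw [hOl]; simp only [Matrix.mul_assoc]
    rw [this, hWW, Matrix.one_mul, Matrix.trace_mul_comm, ← Matrix.mul_assoc, hWW, Matrix.one_mul,
      diagonal_mul_diagonal, Matrix.trace_diagonal]
  have hred : ∀ V, (O * (W * RR ρ V * star W)).trace = ∑ i, l i * RR ρ V i i := by
    intro V
    have : O * (W * RR ρ V * star W) = W * (diagonal l * ((star W * W) * RR ρ V)) * star W := by
      rw [hOl]; simp only [Matrix.mul_assoc]
    rw [this, hWW, Matrix.one_mul, Matrix.trace_mul_comm, ← Matrix.mul_assoc, hWW, Matrix.one_mul]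
    simp [Matrix.trace, Matrix.diagonal_mul]
  constructor
  · rw [← haar_inv μ ρ (fun M => (O * M).trace) W hW]
    simp only [hred]
    rw [integral_finsetSum _ (fun i _ => (ug_integrable μ _ (hc i i)).const_mul _)]
    simp only [integral_const_mul, mom1 hd μ ρ hρ1, htr, ← Finset.sum_mul]
    ring
  · rw [← haar_inv μ ρ (fun M => (O * M).trace ^ 2) W hW]
    have hI : ∀ i j, Integrable (fun V => (l i * l j) * (RR ρ V i i * RR ρ V j j)) μ := fun i j =>
      (ug_integrable μ _ ((hc i i).mul (hc j j))).const_mul _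
    have e : ∀ V, (∑ i, l i * RR ρ V i i) ^ 2
        = ∑ i, ∑ j, (l i * l j) * (RR ρ V i i * RR ρ V j j) := fun V => by
      rw [pow_two, Finset.sum_mul_sum]
      exact Finset.sum_congr rfl fun i _ => Finset.sum_congr rfl fun j _ => by ring
    simp only [hred, e]
    rw [integral_finsetSum _ (fun i _ => integrable_finsetSum _ fun j _ => hI i j)]
    simp only [fun i => integral_finsetSum _ (fun j (_ : j ∈ Finset.univ) => hI i j),
      integral_const_mul, mom2 hd μ ρ hρ1 hρ2, htr, htr2, pow_two, Finset.sum_mul_sum]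
    simp only [mul_div_assoc', ← Finset.sum_div, mul_add, mul_one, Finset.sum_add_distrib]
    simp

lemma trace_int1 {d : ℕ} (μ : Measure (UG d)) [IsProbabilityMeasure μ]
    (ρ O : Matrix (Fin d) (Fin d) ℂ) :
    (O * ∫ V : UG d, V.1 * ρ * star V.1 ∂μ).trace = ∫ V, (O * RR ρ V).trace ∂μ := by
  let L : Matrix (Fin d) (Fin d) ℂ →ₗ[ℂ] ℂ :=
    (Matrix.traceLinearMap (Fin d) ℂ ℂ) ∘ₗ (LinearMap.mulLeft ℂ O)
  exact (ContinuousLinearMap.integral_comp_comm (LinearMap.toContinuousLinearMap L)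
    (ug_integrable μ _ (RR_cont ρ))).symm

lemma trace_int2 {d : ℕ} (μ : Measure (UG d)) [IsProbabilityMeasure μ]
    (ρ O : Matrix (Fin d) (Fin d) ℂ) :
    ((O ⊗ₖ O) * ∫ V : UG d, (V.1 ⊗ₖ V.1) * (ρ ⊗ₖ ρ) * star (V.1 ⊗ₖ V.1) ∂μ).trace
      = ∫ V, (O * RR ρ V).trace ^ 2 ∂μ := by
  let L : Matrix (Fin d × Fin d) (Fin d × Fin d) ℂ →ₗ[ℂ] ℂ :=
    (Matrix.traceLinearMap (Fin d × Fin d) ℂ ℂ) ∘ₗ (LinearMap.mulLeft ℂ (O ⊗ₖ O))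
  have e : ∀ V : UG d, (V.1 ⊗ₖ V.1) * (ρ ⊗ₖ ρ) * star (V.1 ⊗ₖ V.1) = RR ρ V ⊗ₖ RR ρ V := by
    intro V
    rw [star_eq_conjTranspose, conjTranspose_kronecker, ← mul_kronecker_mul, ← mul_kronecker_mul]
    rfl
  simp only [e]
  have hcont : Continuous (fun V : UG d => RR ρ V ⊗ₖ RR ρ V) :=
    continuous_matrix fun a b => (RR_cont' ρ _ _).mul (RR_cont' ρ _ _)
  have h := (ContinuousLinearMap.integral_comp_comm (LinearMap.toContinuousLinearMap L)
    (ug_integrable μ _ hcont)).symm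
  refine h.trans ?_
  congr 1; ext V
  change ((O ⊗ₖ O) * (RR ρ V ⊗ₖ RR ρ V)).trace = _
  rw [← mul_kronecker_mul, trace_kronecker, pow_two]

/-- Exact variance decomposition of the cost under `ν` in terms of the expressivity
operators `A(ρ)` and `A₂(ρ⊗ρ)`:
`Var_ν[C] = β − Tr[(O ⊗ O)·A₂(ρ⊗ρ)] + α·Tr[O·A(ρ)] − (Tr[O·A(ρ)])²`, with
`β = ((Tr[O])² + Tr[O²])/(d² − 1)·(1 − 1/d) − (Tr[O])²/d²` and `α = 2·Tr[O]/d`. -/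
theorem variance_cost_expressivity (d : ℕ) (hd : 2 ≤ d)
    (μ ν : Measure (Matrix.unitaryGroup (Fin d) ℂ))
    [μ.IsHaarMeasure] [IsProbabilityMeasure μ] [IsProbabilityMeasure ν]
    (O : Matrix (Fin d) (Fin d) ℂ) (hO : O.IsHermitian)
    (ρ : Matrix (Fin d) (Fin d) ℂ) (hρ : ρ.PosSemidef)
    (hρ1 : ρ.trace = 1) (hρ2 : ρ * ρ = ρ)
    (Aρ : Matrix (Fin d) (Fin d) ℂ)
    (hAρ : Aρ = (∫ V : Matrix.unitaryGroup (Fin d) ℂ, V.1 * ρ * star V.1 ∂μ)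
              - ∫ U : Matrix.unitaryGroup (Fin d) ℂ, U.1 * ρ * star U.1 ∂ν)
    (A₂ : Matrix (Fin d × Fin d) (Fin d × Fin d) ℂ)
    (hA₂ : A₂ = (∫ V : Matrix.unitaryGroup (Fin d) ℂ,
                    (V.1 ⊗ₖ V.1) * (ρ ⊗ₖ ρ) * star (V.1 ⊗ₖ V.1) ∂μ)
              - ∫ U : Matrix.unitaryGroup (Fin d) ℂ,
                    (U.1 ⊗ₖ U.1) * (ρ ⊗ₖ ρ) * star (U.1 ⊗ₖ U.1) ∂ν)
    (β α : ℂ)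
    (hβ : β = ((O.trace) ^ 2 + (O * O).trace) / ((d : ℂ) ^ 2 - 1) * (1 - 1 / (d : ℂ))
            - (O.trace) ^ 2 / (d : ℂ) ^ 2)
    (hα : α = 2 * O.trace / (d : ℂ)) :
    (∫ U : Matrix.unitaryGroup (Fin d) ℂ, ((O * (U.1 * ρ * star U.1)).trace) ^ 2 ∂ν)
        - (∫ U : Matrix.unitaryGroup (Fin d) ℂ, (O * (U.1 * ρ * star U.1)).trace ∂ν) ^ 2
      = β - ((O ⊗ₖ O) * A₂).trace + α * (O * Aρ).trace - ((O * Aρ).trace) ^ 2 := by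
  have hd0 : (d : ℂ) ≠ 0 := by norm_cast; omega
  have hd1 : (d : ℂ) + 1 ≠ 0 := by norm_cast
  have hd2 : (d : ℂ) - 1 ≠ 0 := by
    rw [sub_ne_zero]; norm_cast; omega
  obtain ⟨m1, m2⟩ := cost_moments hd μ ρ hρ1 hρ2 O hO
  rw [hAρ, hA₂, Matrix.mul_sub, Matrix.mul_sub, Matrix.trace_sub, Matrix.trace_sub,
    trace_int1 μ, trace_int1 ν, trace_int2 μ, trace_int2 ν, m1, m2]
  change (∫ U, (O * RR ρ U).trace ^ 2 ∂ν) - (∫ U, (O * RR ρ U).trace ∂ν) ^ 2 = _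
  have hβ' : β = (O.trace ^ 2 + (O * O).trace) / (d * (d + 1)) - O.trace ^ 2 / (d : ℂ) ^ 2 := by
    rw [hβ, show (d : ℂ) ^ 2 - 1 = (d - 1) * (d + 1) by ring]
    field_simp
  rw [hβ', hα]
  ring
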